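/- arXiv:2506.08385 — 3 statements merged into one kernel-verified Lean document; each statement's English description precedes it below -/
import Mathlib

section
/- Let k be an algebraically closed field and S = k[x_0, …, x_r]. If there exists an m × n 1-generic matrix of homogeneous linear forms in S (with m, n ≥ 1), then r + 1 ≥ m + n − 1. -/
open MvPolynomial

/-- An `m × n` matrix of homogeneous linear forms over `S = k[x_0, …, x_r]` is
`1`-generic if `λᵀ M μ ≠ 0` for all nonzero `λ ∈ k^m`, `μ ∈ k^n`. -/
def IsOneGeneric {k : Type*} [Field k] {m n r : ℕ}
    (M : Matrix (Fin m) (Fin n) (MvPolynomial (Fin (r + 1)) k)) : Prop :=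
  ∀ lam : Fin m → k, lam ≠ 0 → ∀ mu : Fin n → k, mu ≠ 0 →
    (∑ i, ∑ j, C (lam i) * C (mu j) * M i j) ≠ 0


namespace OneGen

/-- the weight with `λ`-variables in degree `1` and `μ`-variables in degree `-1`. -/
def wt (m n : ℕ) : Fin m ⊕ Fin n → ℤ := Sum.elim (fun _ => 1) (fun _ => -1)

/-- The Segre ring: the degree zero part. -/
def segre (k : Type*) [Field k] (m n : ℕ) : Subring (MvPolynomial (Fin m ⊕ Fin n) k) where
  carrier := {p | IsWeightedHomogeneous (wt m n) p 0}
  mul_mem' := by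
    intro a b ha hb
    have := IsWeightedHomogeneous.mul ha hb
    rwa [add_zero] at this
  one_mem' := isWeightedHomogeneous_one _ _
  add_mem' := fun ha hb => IsWeightedHomogeneous.add ha hb
  zero_mem' := isWeightedHomogeneous_zero _ _ _
  neg_mem' := fun ha => IsWeightedHomogeneous.neg ha

variable {k : Type*} [Field k] {m n : ℕ}

lemma mem_segre {p : MvPolynomial (Fin m ⊕ Fin n) k} :
    p ∈ segre k m n ↔ IsWeightedHomogeneous (wt m n) p 0 := Iff.rfl

lemma comp_mul (a b : MvPolynomial (Fin m ⊕ Fin n) k) (hb : IsWeightedHomogeneous (wt m n) b 0) :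
    weightedHomogeneousComponent (wt m n) 0 (a * b) =
      weightedHomogeneousComponent (wt m n) 0 a * b := by
  let _ := weightedGradedAlgebra k (wt m n)
  have h := DirectSum.coe_decompose_mul_of_right_mem_zero
    (weightedHomogeneousSubmodule k (wt m n)) (a := a) (b := b) (i := 0) hb
  have e : ∀ p : MvPolynomial (Fin m ⊕ Fin n) k,
    ((DirectSum.decompose (weightedHomogeneousSubmodule k (wt m n)) p 0 : _) :
      MvPolynomial (Fin m ⊕ Fin n) k) = weightedHomogeneousComponent (wt m n) 0 p :=
    fun p => weightedDecomposition.decompose'_apply k (wt m n) p 0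
  rwa [e, e] at h

lemma comap_map (I : Ideal (segre k m n)) :
    (I.map (segre k m n).subtype).comap (segre k m n).subtype = I := by
  apply le_antisymm _ Ideal.le_comap_map
  have key : ∀ p ∈ I.map (segre k m n).subtype,
      ∃ a ∈ I, (a : MvPolynomial (Fin m ⊕ Fin n) k) =
        weightedHomogeneousComponent (wt m n) 0 p := by
    intro p hp
    refine Submodule.span_induction ?_ ?_ ?_ ?_ hp (p := fun p _ => ∀ r, ∃ a ∈ I,
      (a : MvPolynomial (Fin m ⊕ Fin n) k) = weightedHomogeneousComponent (wt m n) 0 (r * p)) 1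
      |> fun ⟨a, ha, h⟩ => ⟨a, ha, by simpa using h⟩
    · rintro _ ⟨b, hb, rfl⟩ r
      refine ⟨⟨weightedHomogeneousComponent (wt m n) 0 r,
        mem_segre.2 (weightedHomogeneousComponent_isWeightedHomogeneous 0 r)⟩ * b, I.mul_mem_left _ hb, ?_⟩
      exact (comp_mul r b b.2).symm
    · intro r
      exact ⟨0, I.zero_mem, by simp⟩
    · intro x y _ _ hx hy r
      obtain ⟨a, ha, h1⟩ := hx r
      obtain ⟨b, hb, h2⟩ := hy r
      exact ⟨a + b, I.add_mem ha hb, by rw [mul_add, map_add, ← h1, ← h2]; rfl⟩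
    · intro s x _ hx r
      obtain ⟨a, ha, h1⟩ := hx (r * s)
      exact ⟨a, ha, by rw [h1, smul_eq_mul, mul_assoc]⟩
  intro x hx
  obtain ⟨a, ha, h⟩ := key _ hx
  have : a = x := by
    apply Subtype.ext
    rw [h]
    exact weightedHomogeneousComponent_of_mem x.2 |>.trans (if_pos rfl)
  exact this ▸ ha

instance : IsNoetherianRing (segre k m n) := by
  rw [isNoetherianRing_iff, isNoetherian_iff']
  have hm : StrictMono (fun I : Ideal (segre k m n) => I.map (segre k m n).subtype) := by
    apply Monotone.strictMono_of_injective
    · intro I J h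
      exact Ideal.map_mono h
    · intro I J h
      rw [← comap_map I, ← comap_map J]
      exact congrArg _ h
  exact hm.wellFoundedGT

open Classical in
/-- kill the variables in `S`. -/
noncomputable def kill (S : Set (Fin m ⊕ Fin n)) :
    MvPolynomial (Fin m ⊕ Fin n) k →ₐ[k] MvPolynomial (Fin m ⊕ Fin n) k :=
  aeval (fun s => if s ∈ S then 0 else X s)

/-- The prime of the Segre ring. -/
noncomputable def pr (k : Type*) [Field k] {m n : ℕ} (S : Set (Fin m ⊕ Fin n)) :
    Ideal (segre k m n) :=
  RingHom.ker ((kill (k := k) S).toRingHom.comp (segre k m n).subtype)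

instance (S : Set (Fin m ⊕ Fin n)) : (pr k S).IsPrime := RingHom.ker_isPrime _

lemma mem_pr {S : Set (Fin m ⊕ Fin n)} {a : segre k m n} :
    a ∈ pr k S ↔ kill S (a : MvPolynomial (Fin m ⊕ Fin n) k) = 0 := Iff.rfl

lemma pr_mono {S T : Set (Fin m ⊕ Fin n)} (h : S ⊆ T) : pr k S ≤ pr k T := by
  intro a ha
  rw [mem_pr] at *
  have : (kill (k := k) T) = (kill T).comp (kill S) := by
    apply MvPolynomial.algHom_ext
    intro s
    by_cases hs : s ∈ S
    · simp [kill, hs, h hs]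
    · simp [kill, hs]
  rw [this, AlgHom.comp_apply, ha, map_zero]

/-- The element `λ_i μ_j`. -/
noncomputable def xy (k : Type*) [Field k] {m n : ℕ} (i : Fin m) (j : Fin n) : segre k m n :=
  ⟨X (Sum.inl i) * X (Sum.inr j), by
    have := (isWeightedHomogeneous_X k (wt m n) (Sum.inl i)).mul
      (isWeightedHomogeneous_X k (wt m n) (Sum.inr j))
    rw [mem_segre]
    simpa [wt] using this⟩

lemma xy_mem {S : Set (Fin m ⊕ Fin n)} {i : Fin m} {j : Fin n} :
    xy k i j ∈ pr k S ↔ Sum.inl i ∈ S ∨ Sum.inr j ∈ S := by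
  rw [mem_pr]
  by_cases h1 : Sum.inl i ∈ S <;> by_cases h2 : Sum.inr j ∈ S <;> simp [kill, xy, h1, h2]

/-- chain of variable sets -/
def chain (m n t : ℕ) : Set (Fin m ⊕ Fin n) :=
  {s | Sum.elim (fun i : Fin m => (i : ℕ) < t ∧ (i : ℕ) < m - 1)
    (fun j : Fin n => m - 1 + (j : ℕ) < t) s}

lemma height_chain (hm : 1 ≤ m) (hn : 1 ≤ n) (t : ℕ) (ht : t ≤ m + n - 1) :
    (t : ℕ∞) ≤ (pr k (chain m n t)).height := by
  induction t with
  | zero => simp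
  | succ t ih =>
    have hlt : pr k (chain m n t) < pr k (chain m n (t + 1)) := by
      refine lt_of_le_of_ne (pr_mono ?_) ?_
      · rintro (i | j) h
        · simp only [chain, Set.mem_ofPred_eq, Sum.elim_inl] at h ⊢; omega
        · simp only [chain, Set.mem_ofPred_eq, Sum.elim_inr] at h ⊢; omega
      · intro heq
        by_cases h : t < m - 1
        · have h1 : xy k (⟨t, by omega⟩ : Fin m) (⟨n - 1, by omega⟩ : Fin n) ∈
              pr k (chain m n (t + 1)) := xy_mem.2 (Or.inl (by simp [chain, h]))
          rw [← heq, xy_mem] at h1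
          simp only [chain, Set.mem_ofPred_eq, Sum.elim_inl, Sum.elim_inr] at h1
          omega
        · have h1 : xy k (⟨m - 1, by omega⟩ : Fin m) (⟨t - (m - 1), by omega⟩ : Fin n) ∈
              pr k (chain m n (t + 1)) := xy_mem.2 (Or.inr (by
                simp only [chain, Set.mem_ofPred_eq, Sum.elim_inr]; omega))
          rw [← heq, xy_mem] at h1
          simp only [chain, Set.mem_ofPred_eq, Sum.elim_inl, Sum.elim_inr] at h1
          omega
    push_cast
    exact (add_le_add_left (ih (by omega)) 1).trans (Ideal.height_add_one_le_of_lt_of_isPrime hlt)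

lemma const_of_mem {S : Set (Fin m ⊕ Fin n)} {a : segre k m n} (h : a ∈ pr k S) :
    constantCoeff (a : MvPolynomial (Fin m ⊕ Fin n) k) = 0 := by
  have e : (constantCoeff : MvPolynomial (Fin m ⊕ Fin n) k →+* k).comp (kill S).toRingHom =
      constantCoeff := by
    apply MvPolynomial.ringHom_ext
    · intro r; simp [kill]
    · intro s; by_cases hs : s ∈ S <;> simp [kill, hs]
  rw [mem_pr] at h
  rw [← e]
  simp [h]

lemma aeval_zero {a : MvPolynomial (Fin m ⊕ Fin n) k} (ha : IsWeightedHomogeneous (wt m n) a 0)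
    (hc : constantCoeff a = 0) (x : Fin m ⊕ Fin n → k)
    (hx : (∀ i, x (Sum.inl i) = 0) ∨ (∀ j, x (Sum.inr j) = 0)) : aeval x a = 0 := by
  rw [aeval_def, eval₂_eq']
  apply Finset.sum_eq_zero
  intro d hd
  have hd' : coeff d a ≠ 0 := mem_support_iff.1 hd
  have hw := ha hd'
  have hd0 : d ≠ 0 := by
    rintro rfl
    exact hd' hc
  rw [Finsupp.weight_apply, Finsupp.sum_fintype _ _ (by simp), Fintype.sum_sum_type] at hw
  simp only [wt, Sum.elim_inl, Sum.elim_inr, nsmul_eq_mul, mul_one, mul_neg,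
    Finset.sum_neg_distrib] at hw
  have hw2 : ∑ i, d (Sum.inl i) = ∑ j, d (Sum.inr j) := by
    zify; linarith
  have hne : ∑ i, d (Sum.inl i) ≠ 0 := by
    intro h0
    have h1 := h0
    rw [hw2] at h1
    rw [Finset.sum_eq_zero_iff] at h0 h1
    apply hd0
    ext s
    rcases s with i | j
    · exact h0 i (Finset.mem_univ _)
    · exact h1 j (Finset.mem_univ _)
  have : ∃ s, x s = 0 ∧ d s ≠ 0 := by
    rcases hx with hx | hx
    · obtain ⟨i, _, hi⟩ := Finset.exists_ne_zero_of_sum_ne_zero hne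
      exact ⟨_, hx i, hi⟩
    · rw [hw2] at hne
      obtain ⟨i, _, hi⟩ := Finset.exists_ne_zero_of_sum_ne_zero hne
      exact ⟨_, hx i, hi⟩
  obtain ⟨s, h1, h2⟩ := this
  rw [Finset.prod_eq_zero (Finset.mem_univ s) (by rw [h1, zero_pow h2]), mul_zero]

theorem main [IsAlgClosed k] (hm : 1 ≤ m) (hn : 1 ≤ n) {N : ℕ} (c : Fin N → Fin m → Fin n → k)
    (h : ∀ lam : Fin m → k, lam ≠ 0 → ∀ mu : Fin n → k, mu ≠ 0 →
      ∃ l, ∑ i, ∑ j, lam i * mu j * c l i j ≠ 0) : m + n - 1 ≤ N := by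
  classical
  have hC : ∀ r : k, (C r : MvPolynomial (Fin m ⊕ Fin n) k) ∈ segre k m n :=
    fun r => isWeightedHomogeneous_C _ _
  let f : Fin N → segre k m n := fun l => ∑ i, ∑ j, ⟨C (c l i j), hC _⟩ * xy k i j
  have hf : ∀ l x, aeval x (f l : MvPolynomial (Fin m ⊕ Fin n) k) =
      ∑ i, ∑ j, x (Sum.inl i) * x (Sum.inr j) * c l i j := by
    intro l x
    simp only [f, AddSubmonoidClass.coe_finsetSum, map_sum, Subring.coe_mul, map_mul, xy, aeval_X,
      aeval_C]
    refine Finset.sum_congr rfl fun i _ => Finset.sum_congr rfl fun j _ => ?_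
    simp only [Algebra.algebraMap_self, RingHom.id_apply]
    ring
  set P := pr k (chain m n (m + n - 1)) with hP
  have hmin : P ∈ (Ideal.span (Set.range f)).minimalPrimes := by
    refine ⟨⟨inferInstanceAs (pr k _).IsPrime, ?_⟩, ?_⟩
    · rw [Ideal.span_le]
      rintro _ ⟨l, rfl⟩
      refine Ideal.sum_mem _ fun i _ => Ideal.sum_mem _ fun j _ => Ideal.mul_mem_left _ _ ?_
      refine xy_mem.2 (Or.inr ?_)
      simp only [chain, Set.mem_ofPred_eq, Sum.elim_inr]; omega
    · rintro Q ⟨hQ, hJQ⟩ - a ha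
      have hv : (a : MvPolynomial (Fin m ⊕ Fin n) k) ∈ vanishingIdeal k
          (zeroLocus k ((Ideal.span (Set.range f)).map (segre k m n).subtype)) := by
        rw [mem_vanishingIdeal_iff]
        intro x hx
        apply aeval_zero a.2 (const_of_mem ha)
        by_contra hcon
        push Not at hcon
        obtain ⟨⟨i, hi⟩, j, hj⟩ := hcon
        obtain ⟨l, hl⟩ := h (fun i => x (Sum.inl i)) (fun e => hi (congrFun e i))
          (fun j => x (Sum.inr j)) (fun e => hj (congrFun e j))
        apply hl
        rw [← hf]
        exact hx _ (Ideal.mem_map_of_mem (segre k m n).subtype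
          (Ideal.subset_span (Set.mem_range_self l)))
      rw [vanishingIdeal_zeroLocus_eq_radical] at hv
      obtain ⟨s, hs⟩ := hv
      have : a ^ s ∈ Ideal.span (Set.range f) := by
        rw [← comap_map (Ideal.span (Set.range f)), Ideal.mem_comap, map_pow]
        exact hs
      exact hQ.mem_of_pow_mem s (hJQ this)
  have h1 := Ideal.height_le_card_of_mem_minimalPrimes_span (Set.finite_range f) hmin
  have h2 := height_chain (k := k) hm hn (m + n - 1) le_rfl
  have h3 : (Set.range f).ncard ≤ N := by
    rw [← Set.image_univ]
    refine (Set.ncard_image_le Set.finite_univ).trans ?_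
    simp [Set.ncard_univ]
  have h4 := h2.trans h1
  exact (by exact_mod_cast h4 : m + n - 1 ≤ (Set.range f).ncard).trans h3

end OneGen

/-- If over an algebraically closed field `k` there is an `m × n` `1`-generic
matrix of homogeneous linear forms in `k[x_0, …, x_r]` with `m, n ≥ 1`,
then `r + 1 ≥ m + n - 1`. -/
theorem numVars_ge_of_oneGeneric {k : Type*} [Field k] [IsAlgClosed k]
    {m n r : ℕ} (hm : 1 ≤ m) (hn : 1 ≤ n)
    (M : Matrix (Fin m) (Fin n) (MvPolynomial (Fin (r + 1)) k))
    (hM : ∀ i j, (M i j).IsHomogeneous 1)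
    (hgen : IsOneGeneric M) :
    m + n - 1 ≤ r + 1 := by
  apply OneGen.main hm hn (fun (l : Fin (r + 1)) i j => coeff (Finsupp.single l 1) (M i j))
  intro lam hl mu hmu
  by_contra hcon
  push Not at hcon
  apply hgen lam hl mu hmu
  have hh : (∑ i, ∑ j, C (lam i) * C (mu j) * M i j).IsHomogeneous 1 := by
    refine IsHomogeneous.sum _ _ _ fun i _ => IsHomogeneous.sum _ _ _ fun j _ => ?_
    rw [← C_mul]
    exact (hM i j).C_mul _
  ext d
  rw [coeff_zero]
  by_contra hd
  have h1 := hh hd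
  have h2 : Finsupp.weight (fun _ => 1) d = 1 := h1
  rw [← Finsupp.degree_eq_weight_one] at h2
  obtain ⟨l, rfl⟩ := (Finsupp.sum_eq_one_iff d).1 h2
  apply hd
  rw [← hcon l]
  simp only [coeff_sum, ← C_mul, coeff_C_mul]
end

section
/- Let k be an algebraically closed field, S = k[x_0, …, x_r], and M an m × n 1-generic matrix with entries the homogeneous linear forms ℓ_{i,j} ∈ S, where m ≤ n. Let T = k[x_0, …, x_r, y_1, …, y_m] be a polynomial ring in r + 1 + m variables, and for j = 1, …, n let q_j = Σ_{i=1}^m y_i ℓ_{i,j} ∈ T. Then for each t ∈ {1, …, m}, the images of q_1, …, q_n in the localization T[y_t^{-1}] form a regular sequence; equivalently, the ideal they generate in T[y_t^{-1}] has height n. -/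
open MvPolynomial

/-- The height of an ideal: the infimum of the heights (in the prime
spectrum) of the primes containing it. -/
noncomputable def idealHeight {R : Type*} [CommRing R] (I : Ideal R) : ℕ∞ :=
  ⨅ p ∈ {p : PrimeSpectrum R | I ≤ p.asIdeal}, Order.height p

theorem aux_X_regular {L : Type*} [CommRing L] {n : ℕ} (j : Fin n) (f : MvPolynomial (Fin n) L)
    (s : Set (Fin n)) (hj : j ∉ s)
    (h : X j * f ∈ Ideal.span ((X : Fin n → MvPolynomial (Fin n) L) '' s)) :
    f ∈ Ideal.span ((X : Fin n → MvPolynomial (Fin n) L) '' s) := by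
  classical
  rw [mem_ideal_span_X_image] at h ⊢
  intro a ha
  obtain ⟨i, hi, hne⟩ := h (Finsupp.single j 1 + a) (by
    rw [mem_support_iff, coeff_X_mul]
    exact mem_support_iff.mp ha)
  refine ⟨i, hi, ?_⟩
  have hij : j ≠ i := fun e => hj (e ▸ hi)
  simpa [Finsupp.single_apply, hij] using hne

theorem aux_retract {L : Type*} [CommRing L] {n : ℕ} (q : Fin n → L)
    (θ : L →+* MvPolynomial (Fin n) L) (hθ : ∀ j, θ (q j) = X j)
    (hρ : ∀ f, eval q (θ f) = f) (j : Fin n) (f : L) (s : Set (Fin n)) (hj : j ∉ s)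
    (h : q j * f ∈ Ideal.span (q '' s)) : f ∈ Ideal.span (q '' s) := by
  have h1 := Ideal.mem_map_of_mem θ h
  rw [Ideal.map_span, ← Set.image_comp, map_mul, hθ] at h1
  have e : (θ ∘ q) = X := funext hθ
  rw [e] at h1
  have h2 := Ideal.mem_map_of_mem (eval q) (aux_X_regular j _ s hj h1)
  rw [Ideal.map_span, ← Set.image_comp, hρ] at h2
  have e : (eval q ∘ X) = q := funext fun i => by simp
  rwa [e] at h2

theorem aux_height_ge {L : Type*} [CommRing L] {n : ℕ} (q : Fin n → L)
    (H : ∀ (j : Fin n) (f : L), q j * f ∈ Ideal.span (q '' {i | i < j}) →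
      f ∈ Ideal.span (q '' {i | i < j})) (j : ℕ) (hj : j ≤ n) :
    ∀ p : Ideal L, p.IsPrime → Ideal.span (q '' {i | i.val < j}) ≤ p → (j : ℕ∞) ≤ p.height := by
  induction j with
  | zero => intro p _ _; simp
  | succ j ih =>
    intro p hp hle
    have hle' : Ideal.span (q '' {i | i.val < j}) ≤ p :=
      by
      refine le_trans (Ideal.span_mono ?_) hle
      rintro _ ⟨i, hi, rfl⟩
      exact ⟨i, Nat.lt_succ_of_lt hi, rfl⟩
    obtain ⟨p', hp', hpp⟩ := Ideal.exists_minimalPrimes_le hle'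
    have := hp'.1.1
    have hnot : q ⟨j, hj⟩ ∉ p' := by
      intro hmem
      obtain ⟨y, hy, hxy⟩ := Ideal.exists_mul_mem_of_mem_minimalPrimes hp' hmem
      exact hy (H ⟨j, hj⟩ y hxy)
    have hin : q ⟨j, hj⟩ ∈ p := hle (Ideal.subset_span ⟨_, Nat.lt_succ_self j, rfl⟩)
    have hlt : p' < p := lt_of_le_of_ne hpp fun e => hnot (e ▸ hin)
    have h1 := ih (by omega) p' this hp'.1.2
    have h2 := Ideal.height_add_one_le_of_lt_of_isPrime hlt
    push_cast
    exact (add_le_add_left h1 1).trans h2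

theorem aux_final {L : Type*} [CommRing L] [IsNoetherianRing L] {n : ℕ} (q : Fin n → L)
    (H : ∀ (j : Fin n) (f : L), q j * f ∈ Ideal.span (q '' {i | i < j}) →
      f ∈ Ideal.span (q '' {i | i < j})) (hne : Ideal.span (Set.range q) ≠ ⊤) :
    RingTheory.Sequence.IsRegular L (List.ofFn q) ∧
      idealHeight (Ideal.span (Set.range q)) = (n : ℕ∞) := by
  constructor
  · refine ⟨⟨fun i hi => ?_⟩, ?_⟩
    · have hi' : i < n := by simpa using hi
      have e : Ideal.ofList ((List.ofFn q).take i) = Ideal.span (q '' {l | l < ⟨i, hi'⟩}) := by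
        unfold Ideal.ofList
        congr 1
        ext x
        simp only [Set.mem_ofPred_eq, List.mem_take_iff_getElem, Set.mem_image, List.getElem_ofFn,
          List.length_ofFn]
        constructor
        · rintro ⟨a, ha, rfl⟩
          exact ⟨⟨a, by omega⟩, by simp [Fin.lt_def]; omega, rfl⟩
        · rintro ⟨a, ha, rfl⟩
          exact ⟨a, by simp [Fin.lt_def] at ha; omega, rfl⟩
      rw [isSMulRegular_iff_right_eq_zero_of_smul]
      intro x hx
      obtain ⟨f, rfl⟩ := Submodule.Quotient.mk_surjective _ x
      rw [← Submodule.Quotient.mk_smul] at hx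
      rw [Submodule.Quotient.mk_eq_zero, e, smul_eq_mul, Ideal.mul_top] at hx ⊢
      exact H ⟨i, hi'⟩ f (by simpa using hx)
    · intro h
      apply hne
      rw [smul_eq_mul, Ideal.mul_top] at h
      rw [h]
      unfold Ideal.ofList
      congr 1
      ext x
      simp
  · unfold idealHeight
    apply le_antisymm
    · obtain ⟨p, hp⟩ := Ideal.nonempty_minimalPrimes hne
      have hpr := hp.1.1
      refine (iInf₂_le (⟨p, hpr⟩ : PrimeSpectrum L) hp.1.2).trans ?_
      rw [← PrimeSpectrum.height_eq_orderHeight]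
      refine (Ideal.height_le_card_of_mem_minimalPrimes_span (Set.finite_range q) hp).trans ?_
      have := Set.ncard_image_le (f := q) (Set.toFinite (Set.univ : Set (Fin n)))
      rw [Set.image_univ, Set.ncard_univ, Nat.card_fin] at this
      exact_mod_cast this
    · refine le_iInf₂ fun p hp => ?_
      rw [← PrimeSpectrum.height_eq_orderHeight]
      refine aux_height_ge q H n le_rfl _ p.2 (le_trans (Ideal.span_mono ?_) hp)
      exact Set.image_subset_range _ _

/-- surjectivity from surjectivity at all k-points -/
theorem aux_right_inverse {k L : Type*} [Field k] [IsAlgClosed k] [CommRing L] [Algebra k L]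
    [Algebra.FiniteType k L] {n N : ℕ} (B : Matrix (Fin n) (Fin N) L)
    (h : ∀ σ : L →ₐ[k] k, ∀ mu : Fin n → k, (∀ l, ∑ j, mu j * σ (B j l) = 0) → mu = 0) :
    ∃ D : Matrix (Fin N) (Fin n) L, B * D = 1 := by
  rw [← Matrix.mulVec_surjective_iff_exists_right_inverse]
  let R : Submodule L (Fin n → L) := LinearMap.range B.mulVecLin
  suffices hR : R = ⊤ from LinearMap.range_eq_top.mp hR
  suffices ha : Module.annihilator L ((Fin n → L) ⧸ R) = ⊤ by
    have := Module.annihilator_eq_top_iff.mp ha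
    exact (Submodule.Quotient.subsingleton_iff).mp this
  by_contra hne
  obtain ⟨I, hI, hle⟩ := Ideal.exists_le_maximal _ hne
  let _ : Field (L ⧸ I) := Ideal.Quotient.field I
  have hfin : Module.Finite k (L ⧸ I) := finite_of_finite_type_of_isJacobsonRing k (L ⧸ I)
  have hb : Function.Bijective (algebraMap k (L ⧸ I)) :=
    IsAlgClosed.algebraMap_bijective_of_isIntegral
  let e : k ≃ₐ[k] (L ⧸ I) := AlgEquiv.ofBijective (Algebra.ofId k (L ⧸ I)) hb
  let σ : L →ₐ[k] k := (e.symm : (L ⧸ I) →ₐ[k] k).comp (Ideal.Quotient.mkₐ k I)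
  have hσ : ∀ x, σ x = 0 → x ∈ I := fun x hx => by
    have : e.symm (Ideal.Quotient.mk I x) = 0 := hx
    rw [EmbeddingLike.map_eq_zero_iff] at this
    exact Ideal.Quotient.eq_zero_iff_mem.mp this
  have hsurj : Function.Surjective (B.map σ).mulVec := by
    have hli : LinearIndependent k (B.map σ).row := by
      rw [Fintype.linearIndependent_iff]
      intro g hg
      have := h σ g fun l => by
        have := congrFun hg l
        simpa using this
      simp [this]
    have hrk := hli.rank_matrix
    have : LinearMap.range (B.map σ).mulVecLin = ⊤ := by
      apply Submodule.eq_top_of_finrank_eq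
      rw [← Matrix.rank, hrk]; simp
    exact LinearMap.range_eq_top.mp this
  obtain ⟨r, hr, hr0⟩ := Submodule.exists_sub_one_mem_and_smul_eq_zero_of_fg_of_le_smul I
    (⊤ : Submodule L ((Fin n → L) ⧸ R)) Module.Finite.fg_top (by
      intro x _
      obtain ⟨v, rfl⟩ := Submodule.Quotient.mk_surjective _ x
      obtain ⟨w, hw⟩ := hsurj fun j => σ (v j)
      let w' : Fin N → L := fun l => algebraMap k L (w l)
      let d : Fin n → L := v - B.mulVec w'
      have hd : ∀ j, d j ∈ I := fun j => hσ _ (by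
        have := congrFun hw j
        simp only [Matrix.mulVec, dotProduct, Matrix.map_apply] at this
        simp [d, w', Matrix.mulVec, dotProduct, this])
      have : (Submodule.Quotient.mk v : (Fin n → L) ⧸ R) = Submodule.Quotient.mk d := by
        rw [Submodule.Quotient.eq]
        exact ⟨w', by simp [d]⟩
      rw [this, pi_eq_sum_univ d]
      rw [← Submodule.mkQ_apply, map_sum]
      refine Submodule.sum_mem _ fun j _ => ?_
      rw [map_smul]
      exact Submodule.smul_mem_smul (hd j) trivial)
  have hrI : r ∈ I := hle (Module.mem_annihilator.mpr fun x => hr0 x trivial)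
  exact hI.ne_top ((Ideal.eq_top_iff_one I).mpr (by simpa using I.sub_mem hrI hr))

theorem aux_linear {k : Type*} [Field k] {N : ℕ} (f : MvPolynomial (Fin N) k)
    (hf : f.IsHomogeneous 1) : f = ∑ l, C (coeff (Finsupp.single l 1) f) * X l := by
  classical
  ext a
  simp only [coeff_sum, coeff_C_mul, coeff_X]
  by_cases ha : ∃ l, a = Finsupp.single l 1
  · obtain ⟨l, rfl⟩ := ha
    rw [Finset.sum_eq_single l]
    · simp
    · intro b _ hb
      rw [if_neg, mul_zero]
      intro h
      exact hb ((Finsupp.single_left_inj one_ne_zero).mp h)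
    · simp
  · rw [Finset.sum_eq_zero]
    · by_contra hne
      have hdeg := hf hne
      apply ha
      rw [Pi.one_def, ← Finsupp.degree_eq_weight_one] at hdeg
      have ha0 : a ≠ 0 := by
        rintro rfl
        simp at hdeg
      obtain ⟨l, hl⟩ := Finsupp.ne_iff.mp ha0
      have hle : Finsupp.single l 1 ≤ a := by
        rw [Finsupp.single_le_iff]
        exact Nat.one_le_iff_ne_zero.mpr hl
      obtain ⟨b, rfl⟩ := exists_add_of_le hle
      rw [map_add, Finsupp.degree_single] at hdeg
      have hb : b.degree = 0 := by omega
      rw [Finsupp.degree_eq_zero_iff] at hb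
      exact ⟨l, by rw [hb, add_zero]⟩
    · intro l _
      rw [if_neg, mul_zero]
      exact fun h => ha ⟨l, h.symm⟩

theorem aux_main {k L : Type*} [Field k] [IsAlgClosed k] {m n r : ℕ}
    (M : Matrix (Fin m) (Fin n) (MvPolynomial (Fin (r + 1)) k))
    (hM : ∀ i j, (M i j).IsHomogeneous 1)
    (hgen : IsOneGeneric M)
    (q : Fin n → MvPolynomial (Fin (r + 1) ⊕ Fin m) k)
    (hq : ∀ j, q j = ∑ i, X (Sum.inr i) * rename Sum.inl (M i j))
    (t : Fin m) [CommRing L] [Algebra (MvPolynomial (Fin (r + 1) ⊕ Fin m) k) L] [Algebra k L]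
    [IsScalarTower k (MvPolynomial (Fin (r + 1) ⊕ Fin m) k) L]
    [IsLocalization.Away (X (Sum.inr t) : MvPolynomial (Fin (r + 1) ⊕ Fin m) k) L] :
    RingTheory.Sequence.IsRegular L
        (List.ofFn fun j : Fin n =>
          algebraMap (MvPolynomial (Fin (r + 1) ⊕ Fin m) k) L (q j)) ∧
      idealHeight (Ideal.span (Set.range fun j : Fin n =>
          algebraMap (MvPolynomial (Fin (r + 1) ⊕ Fin m) k) L (q j))) = (n : ℕ∞) := by
  let c : Fin m → Fin n → Fin (r + 1) → k := fun i j l => coeff (Finsupp.single l 1) (M i j)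
  have hc : ∀ i j, M i j = ∑ l, C (c i j l) * X l := fun i j => aux_linear _ (hM i j)
  let ι : (MvPolynomial (Fin (r + 1) ⊕ Fin m) k) →+* L := algebraMap (MvPolynomial (Fin (r + 1) ⊕ Fin m) k) L
  let y : Fin m → L := fun i => ι (X (Sum.inr i))
  let x : Fin (r + 1) → L := fun l => ι (X (Sum.inl l))
  have hyt : IsUnit (y t) := IsLocalization.Away.algebraMap_isUnit _
  have hT : ∀ a : k, ι (C a) = algebraMap k L a := fun a =>
    (IsScalarTower.algebraMap_apply k (MvPolynomial (Fin (r + 1) ⊕ Fin m) k) L a).symm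
  let B : Matrix (Fin n) (Fin (r + 1)) L := fun j l => ∑ i, y i * algebraMap k L (c i j l)
  have : Algebra.FiniteType (MvPolynomial (Fin (r + 1) ⊕ Fin m) k) L :=
    have := IsLocalization.Away.finitePresentation (S := L)
      (X (Sum.inr t) : MvPolynomial (Fin (r + 1) ⊕ Fin m) k)
    inferInstance
  have : Algebra.FiniteType k L := Algebra.FiniteType.trans (S := (MvPolynomial (Fin (r + 1) ⊕ Fin m) k)) inferInstance inferInstance
  have : IsNoetherianRing L := IsLocalization.isNoetherianRing (Submonoid.powers (X (Sum.inr t) : (MvPolynomial (Fin (r + 1) ⊕ Fin m) k))) L inferInstance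
  have hqB : ∀ j, ι (q j) = ∑ l, B j l * x l := fun j => by
    rw [hq, map_sum]
    simp only [B, Finset.sum_mul]
    rw [Finset.sum_comm]
    refine Finset.sum_congr rfl fun i _ => ?_
    rw [hc, map_sum, Finset.mul_sum, map_sum]
    refine Finset.sum_congr rfl fun l _ => ?_
    simp only [map_mul, rename_C, rename_X, hT]
    simp only [y, x, mul_assoc]
  obtain ⟨D, hD⟩ := aux_right_inverse (k := k) B (by
    intro σ mu hmu
    by_contra hne
    refine hgen (fun i => σ (y i)) ?_ mu hne ?_
    · intro h0
      have h1 : σ (y t) = 0 := congrFun h0 t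
      exact (hyt.map σ).ne_zero h1
    · simp only [hc, Finset.mul_sum]
      have : ∀ l, ∑ i, ∑ j, σ (y i) * mu j * c i j l = 0 := fun l => by
        rw [← hmu l, Finset.sum_comm]
        refine Finset.sum_congr rfl fun j _ => ?_
        simp only [B, map_sum, map_mul, Finset.mul_sum, AlgHom.commutes]
        refine Finset.sum_congr rfl fun i _ => ?_
        simp only [Algebra.algebraMap_self, RingHom.id_apply]
        ring
      have e : ∑ i, ∑ j, ∑ l, C (σ (y i)) * C (mu j) * (C (c i j l) * X l)
          = ∑ l : Fin (r + 1), C (∑ i, ∑ j, σ (y i) * mu j * c i j l) *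
            (X l : MvPolynomial (Fin (r + 1)) k) := by
        simp only [map_sum, map_mul, Finset.sum_mul]
        rw [Finset.sum_comm (s := (Finset.univ : Finset (Fin (r + 1))))]
        refine Finset.sum_congr rfl fun i _ => ?_
        rw [Finset.sum_comm]
        refine Finset.sum_congr rfl fun l _ => ?_
        refine Finset.sum_congr rfl fun j _ => ?_
        ring
      rw [e]
      simp [this])
  let g : Fin (r + 1) ⊕ Fin m → MvPolynomial (Fin n) L :=
    Sum.elim (fun l => C (x l) + ∑ j, C (D l j) * (X j - C (ι (q j)))) (fun i => C (y i))
  let θ₀ : (MvPolynomial (Fin (r + 1) ⊕ Fin m) k) →+* MvPolynomial (Fin n) L := eval₂Hom (C.comp (algebraMap k L)) g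
  have hunit : IsUnit (θ₀ (X (Sum.inr t))) := by
    have : θ₀ (X (Sum.inr t)) = C (y t) := by simp [θ₀, g]
    rw [this]
    exact hyt.map C
  let θ : L →+* MvPolynomial (Fin n) L := IsLocalization.Away.lift (X (Sum.inr t) : (MvPolynomial (Fin (r + 1) ⊕ Fin m) k)) hunit
  have hθι : ∀ f, θ (ι f) = θ₀ f := fun f => IsLocalization.Away.lift_eq _ hunit f
  have hθx : ∀ l, θ (x l) = C (x l) + ∑ j, C (D l j) * (X j - C (ι (q j))) := fun l => by
    simp only [x, hθι]; simp [θ₀, g, x]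
  have hθy : ∀ i, θ (y i) = C (y i) := fun i => by
    simp only [y, hθι]; simp [θ₀, g, y]
  have hθk : ∀ a, θ (algebraMap k L a) = C (algebraMap k L a) := fun a => by
    rw [← hT, hθι]; simp [θ₀, hT]
  have hθB : ∀ j l, θ (B j l) = C (B j l) := fun j l => by
    simp only [B, map_sum, map_mul, hθy, hθk]
  have hθq : ∀ j, θ (ι (q j)) = X j := fun j => by
    have h1 : ∀ j', ∑ l, B j l * D l j' = if j = j' then 1 else 0 := fun j' => by
      have := congrFun (congrFun hD j) j'
      rwa [Matrix.mul_apply, Matrix.one_apply] at this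
    rw [hqB, map_sum]
    simp only [map_mul, hθB, hθx, mul_add, Finset.sum_add_distrib, Finset.mul_sum]
    rw [Finset.sum_comm]
    have h2 : ∀ j', ∑ l, C (B j l) * (C (D l j') * ((X j' : MvPolynomial (Fin n) L) - C (ι (q j'))))
        = C (if j = j' then 1 else 0) * (X j' - C (ι (q j'))) := fun j' => by
      rw [← h1, map_sum, Finset.sum_mul]
      refine Finset.sum_congr rfl fun l _ => ?_
      rw [map_mul, mul_assoc]
    rw [Finset.sum_congr rfl fun j' _ => h2 j', Finset.sum_eq_single j]
    · rw [if_pos rfl, hqB]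
      simp only [map_sum, map_mul, map_one]
      ring
    · intro b _ hb
      rw [if_neg hb.symm]; simp
    · simp
  have hρ : ∀ f, eval (fun j => ι (q j)) (θ f) = f := by
    have : (eval (fun j => ι (q j))).comp θ = RingHom.id L := by
      apply IsLocalization.ringHom_ext (Submonoid.powers (X (Sum.inr t) : (MvPolynomial (Fin (r + 1) ⊕ Fin m) k)))
      apply MvPolynomial.ringHom_ext
      · intro a
        change eval _ (θ (ι (C a))) = ι (C a)
        rw [hT, hθk, eval_C]
      · rintro (l | i)
        · change eval _ (θ (x l)) = x l
          rw [hθx]; simp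
        · change eval _ (θ (y i)) = y i
          rw [hθy, eval_C]
    exact fun f => congrArg (fun h : L →+* L => h f) this
  refine aux_final (fun j => ι (q j))
    (fun j f h => aux_retract _ θ hθq hρ j f _ (by simp) h) ?_
  intro htop
  let ε₀ : (MvPolynomial (Fin (r + 1) ⊕ Fin m) k) →+* k := eval (Sum.elim (fun _ => 0) (fun _ => 1))
  have hu : IsUnit (ε₀ (X (Sum.inr t))) := by simp [ε₀]
  let ε : L →+* k := IsLocalization.Away.lift (X (Sum.inr t) : (MvPolynomial (Fin (r + 1) ⊕ Fin m) k)) hu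
  have hε : ∀ f, ε (ι f) = ε₀ f := fun f => IsLocalization.Away.lift_eq _ hu f
  have hle : Ideal.span (Set.range fun j => ι (q j)) ≤ RingHom.ker ε := by
    rw [Ideal.span_le]
    rintro _ ⟨j, rfl⟩
    change ε (ι (q j)) = 0
    rw [hqB, map_sum]
    refine Finset.sum_eq_zero fun l _ => ?_
    rw [map_mul]
    simp only [x, hε]
    simp [ε₀]
  rw [htop, top_le_iff] at hle
  exact RingHom.ker_ne_top ε hle

/-- Let `M` be an `m × n` `1`-generic matrix of homogeneous linear forms
`ℓ_{i,j}` in `S = k[x_0, …, x_r]`, `m ≤ n`, over an algebraically closed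
field `k`.  In `T = k[x_0, …, x_r, y_1, …, y_m]` set `q_j = ∑ i, y_i ℓ_{i,j}`.
Then for each `t`, the images of `q_1, …, q_n` in `T[y_t⁻¹]` form a regular
sequence; equivalently, the ideal they generate in `T[y_t⁻¹]` has height `n`. -/
theorem bilinearForms_regularSequence_awayYt {k : Type*} [Field k]
    [IsAlgClosed k] {m n r : ℕ} (hmn : m ≤ n)
    (M : Matrix (Fin m) (Fin n) (MvPolynomial (Fin (r + 1)) k))
    (hM : ∀ i j, (M i j).IsHomogeneous 1)
    (hgen : IsOneGeneric M)
    (q : Fin n → MvPolynomial (Fin (r + 1) ⊕ Fin m) k)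
    (hq : ∀ j, q j = ∑ i, X (Sum.inr i) * rename Sum.inl (M i j))
    (t : Fin m) :
    RingTheory.Sequence.IsRegular
        (Localization.Away (X (Sum.inr t) : MvPolynomial (Fin (r + 1) ⊕ Fin m) k))
        (List.ofFn fun j : Fin n =>
          algebraMap (MvPolynomial (Fin (r + 1) ⊕ Fin m) k)
            (Localization.Away (X (Sum.inr t) : MvPolynomial (Fin (r + 1) ⊕ Fin m) k))
            (q j)) ∧
      idealHeight (Ideal.span (Set.range fun j : Fin n =>
          algebraMap (MvPolynomial (Fin (r + 1) ⊕ Fin m) k)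
            (Localization.Away (X (Sum.inr t) : MvPolynomial (Fin (r + 1) ⊕ Fin m) k))
            (q j))) = (n : ℕ∞) := by
  exact aux_main M hM hgen q hq t
end

section
/- Let k be an algebraically closed field, S = k[x_0, …, x_r], and M an m × n 1-generic matrix of homogeneous linear forms in S with 2 ≤ m ≤ n. Then the ideal I_{m−1}(M) generated by the (m−1) × (m−1) minors of M has height at least n − m + 2 in S; in particular, height I_{m−1}(M) > height I_m(M) = n − m + 1. -/
open MvPolynomial

/-- `I_t(M)`: the ideal generated by the `t × t` minors of `M`. -/
def minorsIdeal {R : Type*} [CommRing R] {m n : ℕ} (t : ℕ)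
    (M : Matrix (Fin m) (Fin n) R) : Ideal R :=
  Ideal.span {d | ∃ (f : Fin t → Fin m) (g : Fin t → Fin n),
    Function.Injective f ∧ Function.Injective g ∧ d = (M.submatrix f g).det}

/-- `M` has a nontrivial left kernel modulo the ideal `Q`. -/
def Degen {R : Type*} [CommRing R] {m n : ℕ} (M : Matrix (Fin m) (Fin n) R) (Q : Ideal R) : Prop :=
  ∃ l : Fin m → R, (∃ i, l i ∉ Q) ∧ ∀ j, ∑ i, l i * M i j ∈ Q

lemma exists_det_ne_zero_of_rows {K : Type*} [Field K] {m n : ℕ} (N : Matrix (Fin m) (Fin n) K)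
    (h : LinearIndependent K N.row) :
    ∃ g : Fin m → Fin n, Function.Injective g ∧ (N.submatrix id g).det ≠ 0 := by
  classical
  obtain ⟨κ, a, ha, hspan, hli⟩ := exists_linearIndependent' K N.col
  have : Finite κ := Finite.of_injective a ha
  have := Fintype.ofFinite κ
  have hr := h.rank_matrix
  rw [Matrix.rank_eq_finrank_span_cols, ← hspan] at hr
  have h2 : Module.finrank K (Submodule.span K (Set.range (N.col ∘ a))) = Fintype.card κ :=
    finrank_span_eq_card hli
  have hc : Fintype.card κ = m := by simpa [h2] using hr
  let e : Fin m ≃ κ := (Fintype.equivFinOfCardEq hc).symm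
  refine ⟨a ∘ e, ha.comp e.injective, ?_⟩
  have h3 : LinearIndependent K (N.submatrix id (a ∘ e)).col := by
    have := hli.comp e e.injective
    exact this
  rw [Matrix.linearIndependent_cols_iff_isUnit, Matrix.isUnit_iff_isUnit_det] at h3
  exact h3.ne_zero

lemma degen_of_minors_le {R : Type*} [CommRing R] {m n : ℕ} {M : Matrix (Fin m) (Fin n) R}
    {Q : Ideal R} [Q.IsPrime] (h : minorsIdeal m M ≤ Q) : Degen M Q := by
  classical
  let K := FractionRing (R ⧸ Q)
  let φ : R →+* K := (algebraMap (R ⧸ Q) K).comp (Ideal.Quotient.mk Q)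
  have hφ : ∀ x, φ x = 0 ↔ x ∈ Q := by
    intro x
    simp only [φ, RingHom.comp_apply]
    rw [FaithfulSMul.algebraMap_eq_zero_iff, Ideal.Quotient.eq_zero_iff_mem]
  have hnl : ¬ LinearIndependent K (M.map φ).row := by
    intro hl
    obtain ⟨g, hg, hd⟩ := exists_det_ne_zero_of_rows _ hl
    apply hd
    have h1 : (M.submatrix id g).det ∈ Q :=
      h (Ideal.subset_span ⟨id, g, Function.injective_id, hg, rfl⟩)
    rw [← hφ, RingHom.map_det] at h1
    exact h1
  rw [← LinearIndependent.iff_fractionRing (R ⧸ Q) K, Fintype.not_linearIndependent_iff] at hnl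
  obtain ⟨c, hc, i, hi⟩ := hnl
  choose l hl using fun i => Ideal.Quotient.mk_surjective (c i)
  refine ⟨l, ⟨i, ?_⟩, ?_⟩
  · rw [← Ideal.Quotient.eq_zero_iff_mem, hl]
    exact hi
  · intro j
    have := congrFun hc j
    rw [← hφ, map_sum]
    simpa [Algebra.smul_def, Finset.sum_apply, ← hl, φ] using this

lemma minors_le_of_degen {R : Type*} [CommRing R] {m n : ℕ} {M : Matrix (Fin m) (Fin n) R}
    {Q : Ideal R} [Q.IsPrime] (h : Degen M Q) : minorsIdeal m M ≤ Q := by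
  classical
  obtain ⟨l, ⟨i, hi⟩, hl⟩ := h
  refine Ideal.span_le.2 ?_
  rintro d ⟨f, g, hf, hg, rfl⟩
  have hfb : Function.Bijective f := Finite.injective_iff_bijective.1 hf
  show _ ∈ Q
  rw [← Ideal.Quotient.eq_zero_iff_mem, RingHom.map_det]
  rw [← Matrix.exists_vecMul_eq_zero_iff]
  refine ⟨fun a => Ideal.Quotient.mk Q (l (f a)), ?_, ?_⟩
  · intro h0
    obtain ⟨a, rfl⟩ := hfb.2 i
    exact hi (Ideal.Quotient.eq_zero_iff_mem.1 (congrFun h0 a))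
  · ext j
    have := Ideal.Quotient.eq_zero_iff_mem.2 (hl (g j))
    rw [← hfb.sum_comp (fun i => l i * M i (g j))] at this
    simpa [Matrix.vecMul, dotProduct] using this

lemma minors_le_iff {R : Type*} [CommRing R] {m n : ℕ} {M : Matrix (Fin m) (Fin n) R}
    {Q : Ideal R} [Q.IsPrime] : minorsIdeal m M ≤ Q ↔ Degen M Q :=
  ⟨degen_of_minors_le, minors_le_of_degen⟩

/-- Chio pivoting. -/
def pivot {R : Type*} [CommRing R] {m n : ℕ} (M : Matrix (Fin (m + 1)) (Fin (n + 1)) R)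
    (a : Fin (m + 1)) (b : Fin (n + 1)) : Matrix (Fin m) (Fin n) R :=
  fun i j => M a b * M (a.succAbove i) (b.succAbove j) - M (a.succAbove i) b * M a (b.succAbove j)

lemma degen_pivot_iff {R : Type*} [CommRing R] {m n : ℕ}
    (M : Matrix (Fin (m + 1)) (Fin (n + 1)) R) (a : Fin (m + 1)) (b : Fin (n + 1))
    (Q : Ideal R) [hQ : Q.IsPrime] (hab : M a b ∉ Q) : Degen (pivot M a b) Q ↔ Degen M Q := by
  constructor
  · rintro ⟨l, ⟨i, hi⟩, hl⟩
    refine ⟨a.insertNth (- ∑ i, l i * M (a.succAbove i) b) (fun i => M a b * l i),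
      ⟨a.succAbove i, ?_⟩, ?_⟩
    · simp only [Fin.insertNth_apply_succAbove]
      exact fun h => (hQ.mem_or_mem h).elim hab hi
    · intro j
      rw [Fin.sum_univ_succAbove _ a]
      simp only [Fin.insertNth_apply_succAbove, Fin.insertNth_apply_same]
      rcases Fin.eq_self_or_eq_succAbove b j with rfl | ⟨j, rfl⟩
      · convert Q.zero_mem
        rw [neg_mul, Finset.sum_mul, neg_add_eq_zero]
        exact Finset.sum_congr rfl fun _ _ => by ring
      · convert hl j using 1
        rw [neg_mul, Finset.sum_mul, neg_add_eq_sub, ← Finset.sum_sub_distrib]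
        exact Finset.sum_congr rfl fun _ _ => by simp only [pivot]; ring
  · rintro ⟨l, ⟨i, hi⟩, hl⟩
    refine ⟨fun i => l (a.succAbove i), ?_, ?_⟩
    · by_contra! hc
      have h1 := hl b
      rw [Fin.sum_univ_succAbove _ a] at h1
      have h2 : l a * M a b ∈ Q := (Ideal.add_mem_iff_left _
        (Ideal.sum_mem _ fun i _ => Ideal.mul_mem_right _ _ (hc i))).1 h1
      rcases Fin.eq_self_or_eq_succAbove a i with rfl | ⟨i, rfl⟩
      · exact (hQ.mem_or_mem h2).elim hi hab
      · exact hi (hc i)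
    · intro j
      have h1 := hl b
      have h2 := hl (b.succAbove j)
      rw [Fin.sum_univ_succAbove _ a] at h1 h2
      convert Q.sub_mem (Q.mul_mem_left (M a b) h2) (Q.mul_mem_left (M a (b.succAbove j)) h1) using 1
      simp only [pivot, mul_add, Finset.mul_sum]
      rw [add_sub_add_comm, ← Finset.sum_sub_distrib]
      rw [show M a b * (l a * M a (b.succAbove j)) - M a (b.succAbove j) * (l a * M a b) = 0 by ring,
        zero_add]
      exact Finset.sum_congr rfl fun _ _ => by ring

lemma height_le_height_map_C {R : Type*} [CommRing R] (P : Ideal R) [P.IsPrime] :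
    P.height ≤ (P.map (Polynomial.C : R →+* Polynomial R)).height := by
  let f : PrimeSpectrum R → PrimeSpectrum (Polynomial R) := fun p =>
    ⟨p.asIdeal.map Polynomial.C, have := p.2; Ideal.isPrime_map_C_of_isPrime⟩
  have hmono : StrictMono f := by
    have hle : ∀ p q, f p ≤ f q ↔ p ≤ q := by
      intro p q
      constructor
      · intro h x hx
        have h1 : Polynomial.C x ∈ q.asIdeal.map Polynomial.C := h (Ideal.mem_map_of_mem _ hx)
        rw [Ideal.mem_map_C_iff] at h1
        simpa using h1 0
      · intro h
        exact Ideal.map_mono h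
    intro p q h
    rw [lt_iff_le_not_ge] at *
    rwa [hle, hle]
  have := Order.height_le_height_apply_of_strictMono f hmono ⟨P, inferInstance⟩
  rw [← PrimeSpectrum.height_eq_orderHeight, ← PrimeSpectrum.height_eq_orderHeight] at this
  exact this

open Polynomial in
/-- The perturbed matrix over `R[X]` still degenerates minimally at `P R[X]`. -/
lemma perturb_minimal {R : Type*} [CommRing R] [IsNoetherianRing R] {m n : ℕ}
    (M : Matrix (Fin (m + 2)) (Fin (n + 1)) R) (P : Ideal R) [P.IsPrime]
    (hP : ∀ i j, M i j ∈ P)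
    (hmin : ∀ Q : Ideal R, Q.IsPrime → Degen M Q → Q ≤ P → Q = P)
    (M' : Matrix (Fin (m + 2)) (Fin (n + 1)) R[X])
    (hM' : M' = M.map Polynomial.C + Matrix.single 0 0 Polynomial.X) :
    Degen M' (P.map Polynomial.C) ∧ ∀ Q : Ideal R[X], Q.IsPrime → Degen M' Q → Q ≤ P.map Polynomial.C → Q = P.map Polynomial.C := by
  have hPC : (P.map Polynomial.C : Ideal R[X]).IsPrime := Ideal.isPrime_map_C_of_isPrime
  have hXP : (Polynomial.X : R[X]) ∉ P.map (Polynomial.C : R →+* R[X]) := by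
    rw [Ideal.mem_map_C_iff]
    intro h
    have := h 1
    rw [coeff_X_one] at this
    exact (Ideal.ne_top_iff_one P).1 (Ideal.IsPrime.ne_top ‹_›) this
  constructor
  · refine ⟨Pi.single 1 1, ⟨1, ?_⟩, ?_⟩
    · rw [Pi.single_eq_same]
      exact (Ideal.ne_top_iff_one _).1 hPC.ne_top
    · intro j
      rw [Finset.sum_eq_single 1 (by
        intro b _ hb
        simp [Pi.single_eq_of_ne hb]) (by simp)]
      rw [hM']
      simp only [Pi.single_eq_same, one_mul, Matrix.add_apply, Matrix.map_apply]
      rw [Matrix.single_apply_of_row_ne (by simp), add_zero]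
      exact Ideal.mem_map_of_mem _ (hP _ _)
  · intro Q hQ hdeg hQP
    let ev : R[X] →+* R := Polynomial.constantCoeff
    let P1 : Ideal R[X] := P.comap ev
    have hPP1 : P.map Polynomial.C ≤ P1 := by
      rw [Ideal.map_le_iff_le_comap]
      intro x hx
      simpa [P1, ev] using hx
    have hXP1 : Polynomial.X ∈ P1 := by simp [P1, ev]
    have hlt : P.map Polynomial.C < P1 := lt_of_le_of_ne hPP1 (fun h => hXP (h ▸ hXP1))
    have hmin1 : P1 ∈ (Q ⊔ Ideal.span {Polynomial.X}).minimalPrimes := by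
      refine ⟨⟨inferInstance, sup_le (hQP.trans hPP1) ?_⟩, ?_⟩
      · rw [Ideal.span_singleton_le_iff_mem]
        exact hXP1
      · rintro Q1 ⟨hQ1, hle⟩ hQ1P
        have hX1 : Polynomial.X ∈ Q1 := hle (Ideal.mem_sup_right (Ideal.mem_span_singleton_self Polynomial.X))
        have key : ∀ f : R[X], f ∈ Q1 ↔ Polynomial.C (ev f) ∈ Q1 := by
          intro f
          conv_lhs => rw [← divX_mul_X_add f]
          rw [Ideal.add_mem_iff_right _ (Ideal.mul_mem_left _ _ hX1)]
          rfl
        have hd1 : Degen M' Q1 := degen_of_minors_le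
          ((minors_le_of_degen hdeg).trans (le_sup_left.trans hle))
        have hd2 : Degen M (Q1.comap Polynomial.C) := by
          obtain ⟨l, ⟨i, hi⟩, hl⟩ := hd1
          refine ⟨fun i => ev (l i), ⟨i, ?_⟩, ?_⟩
          · rw [Ideal.mem_comap, ← key]
            exact hi
          · intro j
            have := hl j
            rw [key, map_sum] at this
            rw [Ideal.mem_comap]
            convert this using 3 with i
            rw [map_mul, hM']
            congr 1
            simp only [Matrix.add_apply, Matrix.map_apply, map_add, Matrix.single_apply]
            split_ifs <;> simp [ev]
        have hq := hmin _ inferInstance hd2 (by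
          intro x hx
          have := hQ1P hx
          simpa [P1, ev] using this)
        intro f hf
        rw [key]
        have : ev f ∈ P := hf
        rw [← hq] at this
        exact this
    have hht := Ideal.map_height_le_one_of_mem_minimalPrimes hmin1
    by_contra hne
    have hlt0 : Q < P.map Polynomial.C := lt_of_le_of_ne hQP hne
    have pr : ∀ I : Ideal R[X], I.IsPrime → Q ≤ I → (I.map (Ideal.Quotient.mk Q)).IsPrime :=
      fun I hI h => Ideal.map_isPrime_of_surjective Ideal.Quotient.mk_surjective (by simpa using h)
    have hback : ∀ I : Ideal R[X], Q ≤ I → (I.map (Ideal.Quotient.mk Q)).comap (Ideal.Quotient.mk Q) = I := by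
      intro I h
      rw [Ideal.comap_map_of_surjective _ Ideal.Quotient.mk_surjective]
      simpa [← RingHom.ker_eq_comap_bot] using h
    have st : ∀ I J : Ideal R[X], Q ≤ I → I < J →
        I.map (Ideal.Quotient.mk Q) < J.map (Ideal.Quotient.mk Q) := by
      intro I J h1 h2
      refine lt_of_le_of_ne (Ideal.map_mono h2.le) fun h => h2.ne ?_
      rw [← hback I h1, h, hback J (h1.trans h2.le)]
    have i0 := pr Q hQ le_rfl
    have i1 := pr (P.map Polynomial.C) hPC hQP
    have i2 := pr P1 inferInstance (hQP.trans hPP1)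
    have h1 := Ideal.height_add_one_le_of_lt_of_isPrime (st _ _ le_rfl hlt0)
    have h2 := Ideal.height_add_one_le_of_lt_of_isPrime (st _ _ hQP hlt)
    have h3 := h2.trans hht
    have h4 : (1 : ℕ∞) + 1 ≤ 1 := le_trans (by gcongr; exact le_trans (by simp) h1) h3
    exact absurd h4 (by decide)

/-- The generalized principal ideal theorem for maximal minors. -/
theorem height_le_of_minimal_degen (m : ℕ) : ∀ {R : Type*} [CommRing R] [IsNoetherianRing R] {n : ℕ}
    (M : Matrix (Fin (m + 1)) (Fin (n + m)) R) (P : Ideal R) [P.IsPrime] (_ : Degen M P)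
    (_ : ∀ Q : Ideal R, Q.IsPrime → Degen M Q → Q ≤ P → Q = P), P.height ≤ (n : ℕ∞) := by
  induction m with
  | zero =>
    intro R _ _ n M P hPr hd hmin
    have hmem : P ∈ (Ideal.span (Set.range (M 0))).minimalPrimes := by
      refine ⟨⟨hPr, ?_⟩, ?_⟩
      · rw [Ideal.span_le]
        rintro _ ⟨j, rfl⟩
        obtain ⟨l, ⟨i, hi⟩, hl⟩ := hd
        have := hl j
        simp only [Nat.reduceAdd, Finset.univ_unique, Fin.default_eq_zero, Finset.sum_singleton] at this
        obtain rfl : i = 0 := by omega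
        exact (hPr.mem_or_mem this).resolve_left hi
      · rintro Q ⟨hQ, hle⟩ hQP
        refine (hmin Q hQ ⟨fun _ => 1, ⟨0, (Ideal.ne_top_iff_one _).1 hQ.ne_top⟩, ?_⟩ hQP).ge
        intro j
        simp only [Nat.reduceAdd, Finset.univ_unique, Fin.default_eq_zero, Finset.sum_singleton,
          one_mul]
        exact hle (Ideal.subset_span ⟨j, rfl⟩)
    refine (Ideal.height_le_card_of_mem_minimalPrimes_span (Set.finite_range _) hmem).trans ?_
    have h1 : (Set.range (M 0)).ncard ≤ n := by
      rw [← Set.image_univ]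
      refine (Set.ncard_image_le Set.finite_univ).trans ?_
      simp
    exact_mod_cast h1
  | succ m ih =>
    have caseA : ∀ {R : Type _} [CommRing R] [IsNoetherianRing R] {n : ℕ}
        (M : Matrix (Fin (m + 1 + 1)) (Fin (n + m + 1)) R) (P : Ideal R) [P.IsPrime] (_ : Degen M P)
        (_ : ∀ Q : Ideal R, Q.IsPrime → Degen M Q → Q ≤ P → Q = P)
        (a : Fin (m + 1 + 1)) (b : Fin (n + m + 1)) (_ : M a b ∉ P), P.height ≤ (n : ℕ∞) := by
      intro R _ _ n M P hPr hd hmin a b hab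
      refine ih (pivot M a b) P ((degen_pivot_iff M a b P hab).2 hd) ?_
      intro Q hQ hdQ hQP
      exact hmin Q hQ ((degen_pivot_iff M a b Q fun h => hab (hQP h)).1 hdQ) hQP
    intro R _ _ n M P hPr hd hmin
    by_cases hall : ∀ i j, M i j ∈ P
    · obtain ⟨h1, h2⟩ := perturb_minimal (m := m) (n := n + m) M P hall hmin _ rfl
      have hPC : (P.map Polynomial.C : Ideal (Polynomial R)).IsPrime :=
        Ideal.isPrime_map_C_of_isPrime
      refine (height_le_height_map_C P).trans (caseA _ _ h1 h2 0 0 ?_)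
      intro hmem
      rw [Ideal.mem_map_C_iff] at hmem
      have := hmem 1
      simp at this
      exact (Ideal.ne_top_iff_one P).1 (Ideal.IsPrime.ne_top ‹_›) this
    · push Not at hall
      obtain ⟨a, b, hab⟩ := hall
      exact caseA M P hd hmin a b hab

lemma exists_coeffs_of_isHomogeneous_one {k : Type*} [Field k] {N : ℕ}
    {p : MvPolynomial (Fin N) k} (hp : p.IsHomogeneous 1) :
    ∃ c : Fin N → k, p = ∑ a, C (c a) * X a := by
  have h : p ∈ homogeneousSubmodule (Fin N) k 1 := hp
  rw [homogeneousSubmodule_one_eq_span_X, Submodule.mem_span_range_iff_exists_fun] at h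
  obtain ⟨c, hc⟩ := h
  exact ⟨c, by rw [← hc]; simp [MvPolynomial.smul_eq_C_mul]⟩

lemma oneGeneric_extend {k K : Type*} [Field k] [IsAlgClosed k] [Field K] [Algebra k K]
    {m n N : ℕ} (t : Fin m → Fin n → Fin N → k)
    (ht : ∀ v : Fin m → k, v ≠ 0 → ∀ w : Fin n → k, w ≠ 0 →
      ∃ a, ∑ i, ∑ j, v i * w j * t i j a ≠ 0)
    (v : Fin m → K) (hv : v ≠ 0) (w : Fin n → K) (hw : w ≠ 0) :
    ∃ a, ∑ i, ∑ j, v i * w j * algebraMap k K (t i j a) ≠ 0 := by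
  by_contra! hc
  obtain ⟨i0, hi0⟩ := Function.ne_iff.1 hv
  obtain ⟨j0, hj0⟩ := Function.ne_iff.1 hw
  simp only [Pi.zero_apply] at hi0 hj0
  let z : Fin m ⊕ Fin n → K := Sum.elim (fun i => v i / v i0) (fun j => w j / w j0)
  let I : Ideal (MvPolynomial (Fin m ⊕ Fin n) k) := RingHom.ker (aeval z : _ →ₐ[k] K)
  have hI : I ≠ ⊤ := RingHom.ker_ne_top _
  obtain ⟨J, hJ, hIJ⟩ := Ideal.exists_le_maximal I hI
  obtain ⟨x, hx⟩ := eq_vanishingIdeal_singleton_of_isMaximal k hJ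
  have hev : ∀ p : MvPolynomial (Fin m ⊕ Fin n) k, aeval z p = 0 → aeval x p = 0 := by
    intro p hp
    have : p ∈ J := hIJ hp
    rw [hx] at this
    exact (mem_vanishingIdeal_singleton_iff x p).1 this
  have h1 := hev (X (Sum.inl i0) - 1) (by simp [z, hi0])
  have h2 := hev (X (Sum.inr j0) - 1) (by simp [z, hj0])
  simp only [map_sub, aeval_X, map_one, sub_eq_zero] at h1 h2
  obtain ⟨a, ha⟩ := ht (fun i => x (Sum.inl i)) (fun h => by simpa [h1] using congrFun h i0)
    (fun j => x (Sum.inr j)) (fun h => by simpa [h2] using congrFun h j0)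
  apply ha
  have h3 := hev (∑ i, ∑ j, X (Sum.inl i) * X (Sum.inr j) * C (t i j a)) (by
    have : aeval z (∑ i, ∑ j, X (Sum.inl i) * X (Sum.inr j) * C (t i j a) :
        MvPolynomial (Fin m ⊕ Fin n) k)
        = (∑ i, ∑ j, v i * w j * algebraMap k K (t i j a)) / (v i0 * w j0) := by
      simp only [map_sum, map_mul, aeval_X, z, Sum.elim_inl, Sum.elim_inr, Finset.sum_div,
        algHom_C]
      refine Finset.sum_congr rfl fun i _ => Finset.sum_congr rfl fun j _ => ?_
      field_simp
    rw [this, hc a, zero_div])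
  simpa using h3

lemma exists_dual {K : Type*} [Field K] {n N : ℕ} (c : Matrix (Fin n) (Fin N) K)
    (hc : ∀ w : Fin n → K, w ≠ 0 → ∃ a, ∑ j, w j * c j a ≠ 0) :
    ∃ u : Matrix (Fin N) (Fin n) K, c * u = 1 := by
  classical
  have hli : LinearIndependent K c.row := by
    rw [Fintype.linearIndependent_iff]
    intro w hw
    by_contra! h
    obtain ⟨i, hi⟩ := h
    obtain ⟨a, ha⟩ := hc w (fun h => hi (congrFun h i))
    apply ha
    simpa using congrFun hw a
  have hr := hli.rank_matrix
  rw [← Matrix.mulVec_surjective_iff_exists_right_inverse]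
  have : LinearMap.range c.mulVecLin = ⊤ := by
    apply Submodule.eq_top_of_finrank_eq
    rw [Module.finrank_fintype_fun_eq_card]
    exact hr
  exact LinearMap.range_eq_top.1 this

lemma height_ge_of_forms {T K : Type*} [CommRing T] [Field K] {n N : ℕ}
    (ψ : T →+* MvPolynomial (Fin N) K) (g : Fin n → T) (c : Matrix (Fin n) (Fin N) K)
    (u : Matrix (Fin N) (Fin n) K) (hu : c * u = 1)
    (hg : ∀ j, ψ (g j) = ∑ a, C (c j a) * X a)
    (x : Fin N → K) (hx : ∀ j, ∑ a, c j a * x a = 0) :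
    (n : ℕ∞) ≤ (RingHom.ker ((eval x).comp ψ)).height := by
  classical
  let L : Fin n → MvPolynomial (Fin N) K := fun j => ∑ a, C (c j a) * X a
  let φ : ℕ → MvPolynomial (Fin N) K →ₐ[K] MvPolynomial (Fin N) K := fun s =>
    aeval fun a => X a - ∑ i ∈ Finset.univ.filter (fun i : Fin n => i.1 < s), C (u a i) * L i
  have hφX : ∀ s a, φ s (X a) =
      X a - ∑ i ∈ Finset.univ.filter (fun i : Fin n => i.1 < s), C (u a i) * L i := by
    intro s a; simp [φ]
  have hφL : ∀ s j, φ s (L j) = if j.1 < s then 0 else L j := by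
    intro s j
    have h1 : φ s (L j) = L j - ∑ i ∈ Finset.univ.filter (fun i : Fin n => i.1 < s),
        C ((c * u) j i) * L i := by
      simp only [L, map_sum, map_mul, algHom_C, algebraMap_eq, hφX, mul_sub, Finset.sum_sub_distrib]
      congr 1
      simp only [Finset.mul_sum]
      rw [Finset.sum_comm]
      refine Finset.sum_congr rfl fun i _ => ?_
      rw [Matrix.mul_apply, map_sum]
      simp only [Finset.sum_mul]
      rw [Finset.sum_comm]
      refine Finset.sum_congr rfl fun a _ => ?_
      refine Finset.sum_congr rfl fun b _ => ?_
      rw [map_mul]; ring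
    rw [h1, hu]
    split_ifs with h
    · rw [Finset.sum_eq_single j]
      · simp
      · intro b _ hb
        simp [Matrix.one_apply_ne hb.symm]
      · simp [h]
    · rw [Finset.sum_eq_zero, sub_zero]
      intro i hi
      have : j ≠ i := by
        rintro rfl
        exact h (Finset.mem_filter.1 hi).2
      simp [Matrix.one_apply_ne this]
  have hφφ : ∀ s p, φ (s + 1) (φ s p) = φ (s + 1) p := by
    intro s p
    rw [← AlgHom.comp_apply]
    congr 1
    ext1 a
    simp only [AlgHom.comp_apply, hφX, map_sub, map_sum, map_mul, hφL]
    rw [sub_eq_self]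
    refine Finset.sum_eq_zero fun i hi => ?_
    rw [if_pos (Nat.lt_succ_of_lt (Finset.mem_filter.1 hi).2), mul_zero]
  let Q : ℕ → Ideal T := fun s => RingHom.ker ((φ s).toRingHom.comp ψ)
  have hQ : ∀ s, (Q s).IsPrime := fun s => RingHom.ker_isPrime _
  have hLne : ∀ j, L j ≠ 0 := by
    intro j h
    have h2 := congrArg (eval fun a => u a j) h
    simp only [L, map_sum, map_mul, eval_C, eval_X, map_zero] at h2
    have h3 := congrFun (congrFun hu j) j
    rw [Matrix.mul_apply, h2] at h3
    simp at h3
  have hlt : ∀ s, s < n → Q s < Q (s + 1) := by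
    intro s hs
    refine lt_of_le_of_ne ?_ ?_
    · intro f hf
      have hf' : φ s (ψ f) = 0 := hf
      show φ (s + 1) (ψ f) = 0
      rw [← hφφ, hf', map_zero]
    · intro h
      have h1 : g ⟨s, hs⟩ ∈ Q (s + 1) := by
        show φ (s + 1) (ψ _) = 0
        rw [hg]
        exact (hφL (s + 1) ⟨s, hs⟩).trans (if_pos (Nat.lt_succ_self s))
      rw [← h] at h1
      have h2 : φ s (ψ (g ⟨s, hs⟩)) = 0 := h1
      rw [hg] at h2
      have h3 := (hφL s ⟨s, hs⟩).symm.trans h2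
      rw [if_neg (lt_irrefl s)] at h3
      exact hLne _ h3
  have hht : ∀ s, s ≤ n → (s : ℕ∞) ≤ (Q s).height := by
    intro s
    induction s with
    | zero => simp
    | succ s ih =>
      intro hs
      have := hQ s
      have := hQ (s + 1)
      refine le_trans ?_ (Ideal.height_add_one_le_of_lt_of_isPrime (hlt s hs))
      push_cast
      gcongr
      exact ih (by omega)
  refine (hht n le_rfl).trans (Ideal.height_mono ?_)
  intro f hf
  have hf' : φ n (ψ f) = 0 := hf
  show eval x (ψ f) = 0
  have hcomp : ∀ p, aeval x (φ n p) = aeval x p := by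
    intro p
    rw [← AlgHom.comp_apply]
    congr 1
    ext1 a
    simp only [AlgHom.comp_apply, hφX, map_sub, map_sum, map_mul]
    rw [sub_eq_self]
    refine Finset.sum_eq_zero fun i hi => ?_
    have : aeval x (L i) = 0 := by
      simp only [L, map_sum, map_mul, algHom_C, aeval_X]
      exact hx i
    rw [this, mul_zero]
  have := hcomp (ψ f)
  rw [hf', map_zero] at this
  rw [← coe_aeval_eq_eval]
  exact this.symm

lemma height_le_of_fiber {R K : Type*} [CommRing R] [IsNoetherianRing R] [Field K] {s : ℕ}
    (P : Ideal R) [P.IsPrime] (φ : R →+* K) (hφ : ∀ x, φ x = 0 ↔ x ∈ P) (a : R) (ha : a ∉ P)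
    (b : Fin s → R) (W : Ideal (MvPolynomial (Fin s) R))
    (hW : W = RingHom.ker (eval₂Hom φ fun i => φ (b i) / φ a)) :
    W.height ≤ P.height + s := by
  classical
  have hWp : W.IsPrime := hW ▸ RingHom.ker_isPrime _
  have hmemW : ∀ f, f ∈ W ↔ eval₂Hom φ (fun i => φ (b i) / φ a) f = 0 := by
    intro f; rw [hW, RingHom.mem_ker]
  have hCW : ∀ r, C r ∈ W ↔ r ∈ P := by
    intro r; rw [hmemW, ← hφ]; simp
  have hφa : φ a ≠ 0 := fun h => ha ((hφ a).1 h)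
  have hlies : W.LiesOver P := ⟨by ext r; exact (hCW r).symm⟩
  refine (Ideal.height_le_height_add_of_liesOver P W).trans ?_
  gcongr
  set PT := P.map (algebraMap R (MvPolynomial (Fin s) R)) with hPT
  let G : Fin s → MvPolynomial (Fin s) R := fun i => C a * X i - C (b i)
  have hGW : ∀ i, G i ∈ W := by
    intro i
    rw [hmemW]
    simp only [G, map_sub, map_mul, coe_eval₂Hom, eval₂_C, eval₂_X]
    field_simp
    simp
  have hPTW : PT ≤ W := by
    rw [hPT, Ideal.map_le_iff_le_comap]
    intro r hr
    exact (hCW r).2 hr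
  have hred : ∀ f : MvPolynomial (Fin s) R, ∃ (e : ℕ) (r : R),
      C a ^ e * f - C r ∈ Ideal.span (Set.range G) := by
    intro f
    induction f using MvPolynomial.induction_on with
    | C r => exact ⟨0, r, by simp⟩
    | add p q hp hq =>
      obtain ⟨e, r, h⟩ := hp
      obtain ⟨e', r', h'⟩ := hq
      refine ⟨e + e', a ^ e' * r + a ^ e * r', ?_⟩
      convert Ideal.add_mem _ (Ideal.mul_mem_left _ (C a ^ e') h)
        (Ideal.mul_mem_left _ (C a ^ e) h') using 1
      simp only [map_add, map_mul, map_pow]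
      ring
    | mul_X p i hp =>
      obtain ⟨e, r, h⟩ := hp
      refine ⟨e + 1, r * b i, ?_⟩
      convert Ideal.add_mem _ (Ideal.mul_mem_left _ (C a * X i) h)
        (Ideal.mul_mem_left _ (C r) (Ideal.subset_span ⟨i, rfl⟩ : G i ∈ Ideal.span (Set.range G))) using 1
      simp only [map_mul, G]
      ring
  have hmin : W.map (Ideal.Quotient.mk PT) ∈
      (Ideal.span (Set.range fun i => Ideal.Quotient.mk PT (G i))).minimalPrimes := by
    refine ⟨⟨Ideal.map_isPrime_of_surjective Ideal.Quotient.mk_surjective (by simpa using hPTW), ?_⟩, ?_⟩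
    · rw [Ideal.span_le]
      rintro _ ⟨i, rfl⟩
      exact Ideal.mem_map_of_mem _ (hGW i)
    · rintro Q ⟨hQ, hle⟩ hQW
      rw [Ideal.map_le_iff_le_comap]
      intro f hf
      have hGQ : Ideal.span (Set.range G) ≤ Q.comap (Ideal.Quotient.mk PT) := by
        rw [Ideal.span_le]
        rintro _ ⟨i, rfl⟩
        exact hle (Ideal.subset_span ⟨i, rfl⟩)
      obtain ⟨e, r, h⟩ := hred f
      have h1 : C a ^ e * f - C r ∈ W :=
        (Ideal.span_le.2 (by rintro _ ⟨i, rfl⟩; exact hGW i) : Ideal.span (Set.range G) ≤ W) h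
      have h2 : C r ∈ W := (Submodule.sub_mem_iff_right _ (Ideal.mul_mem_left _ _ hf)).1 h1
      have h3 : C r ∈ PT := Ideal.mem_map_of_mem _ ((hCW r).1 h2)
      have h4 : C r ∈ Q.comap (Ideal.Quotient.mk PT) := by
        rw [Ideal.mem_comap, Ideal.Quotient.eq_zero_iff_mem.2 h3]
        exact Q.zero_mem
      have h5 : C a ^ e * f ∈ Q.comap (Ideal.Quotient.mk PT) := by
        have := Ideal.add_mem _ (hGQ h) h4
        simpa using this
      have hQ' : (Q.comap (Ideal.Quotient.mk PT)).IsPrime := inferInstance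
      refine (hQ'.mem_or_mem h5).resolve_left fun h6 => ?_
      have h7 := hQ'.mem_of_pow_mem _ h6
      have h8 : C a ∈ (W.map (Ideal.Quotient.mk PT)).comap (Ideal.Quotient.mk PT) := hQW h7
      rw [Ideal.comap_map_of_surjective _ Ideal.Quotient.mk_surjective,
        ← RingHom.ker_eq_comap_bot, Ideal.mk_ker, sup_eq_left.2 hPTW] at h8
      exact ha ((hCW a).1 h8)
  refine (Ideal.height_le_card_of_mem_minimalPrimes_span (Set.finite_range _) hmin).trans ?_
  have h1 : (Set.range fun i => Ideal.Quotient.mk PT (G i)).ncard ≤ s := by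
    rw [← Set.image_univ]
    refine (Set.ncard_image_le Set.finite_univ).trans ?_
    simp
  exact_mod_cast h1

/-- Lower bound: a prime at which a `1`-generic matrix degenerates has large height. -/
theorem le_height_of_degen_aux {k K : Type*} [Field k] [IsAlgClosed k] [Field K] [Algebra k K]
    {m n r : ℕ}
    (M : Matrix (Fin (m + 1)) (Fin n) (MvPolynomial (Fin (r + 1)) k))
    (hM : ∀ i j, (M i j).IsHomogeneous 1) (hgen : IsOneGeneric M)
    (P : Ideal (MvPolynomial (Fin (r + 1)) k)) [P.IsPrime] (hd : Degen M P)
    (φ : MvPolynomial (Fin (r + 1)) k →+* K) (hφ : ∀ x, φ x = 0 ↔ x ∈ P)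
    (hφC : ∀ c : k, φ (C c) = algebraMap k K c) :
    (n : ℕ∞) ≤ P.height + m := by
  classical
  choose t ht using fun i j => exists_coeffs_of_isHomogeneous_one (hM i j)
  have htgen : ∀ v : Fin (m + 1) → k, v ≠ 0 → ∀ w : Fin n → k, w ≠ 0 →
      ∃ a, ∑ i, ∑ j, v i * w j * t i j a ≠ 0 := by
    intro v hv w hw
    by_contra! hc
    apply hgen v hv w hw
    have : ∑ i, ∑ j, C (v i) * C (w j) * M i j
        = ∑ a, C (∑ i, ∑ j, v i * w j * t i j a) * (X a : MvPolynomial (Fin (r + 1)) k) := by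
      simp only [ht, map_sum, Finset.mul_sum, Finset.sum_mul, map_mul]
      conv_rhs => rw [Finset.sum_comm]
      refine Finset.sum_congr rfl fun i _ => ?_
      rw [Finset.sum_comm]
      refine Finset.sum_congr rfl fun a _ => ?_
      refine Finset.sum_congr rfl fun j _ => ?_
      ring
    rw [this]
    simp [hc]
  obtain ⟨l, ⟨i0, hi0⟩, hl⟩ := hd
  have hφi0 : φ (l i0) ≠ 0 := fun h => hi0 ((hφ _).1 h)
  let v : Fin (m + 1) → K := fun i => φ (l i) / φ (l i0)
  have hv0 : v i0 = 1 := div_self hφi0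
  have hv : v ≠ 0 := fun h => by simpa [hv0] using congrFun h i0
  let c : Matrix (Fin n) (Fin (r + 1)) K :=
    Matrix.of fun j a => ∑ i, v i * algebraMap k K (t i j a)
  obtain ⟨u, hu⟩ := exists_dual c (by
    intro w hw
    obtain ⟨a, ha⟩ := oneGeneric_extend t htgen v hv w hw
    refine ⟨a, ?_⟩
    convert ha using 1
    rw [Finset.sum_comm]
    refine Finset.sum_congr rfl fun j _ => ?_
    simp only [c, Matrix.of_apply, Finset.mul_sum]
    exact Finset.sum_congr rfl fun i _ => by ring)
  let ψ : MvPolynomial (Fin m) (MvPolynomial (Fin (r + 1)) k) →+* MvPolynomial (Fin (r + 1)) K :=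
    eval₂Hom (map (algebraMap k K)) (fun i => C (v (i0.succAbove i)))
  let vT : Fin (m + 1) → MvPolynomial (Fin m) (MvPolynomial (Fin (r + 1)) k) :=
    i0.insertNth 1 X
  have hψv : ∀ i, ψ (vT i) = C (v i) := by
    intro i
    rcases Fin.eq_self_or_eq_succAbove i0 i with rfl | ⟨i, rfl⟩
    · simp [vT, hv0]
    · simp [vT, ψ]
  have hlow := height_ge_of_forms ψ (fun j => ∑ i, vT i * C (M i j)) c u hu (by
    intro j
    simp only [map_sum, map_mul, hψv, c, Matrix.of_apply, Finset.sum_mul]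
    rw [Finset.sum_comm]
    refine Finset.sum_congr rfl fun i _ => ?_
    simp only [ψ, coe_eval₂Hom, eval₂_C]
    rw [ht i j, map_sum, Finset.mul_sum]
    refine Finset.sum_congr rfl fun a _ => ?_
    simp [mul_assoc]) (fun a => φ (X a)) (by
    intro j
    have h1 := (hφ _).2 (hl j)
    have h2 : ∑ a, c j a * φ (X a) = φ (∑ i, l i * M i j) / φ (l i0) := by
      simp only [c, Matrix.of_apply, Finset.sum_mul, map_sum, map_mul, Finset.sum_div]
      rw [Finset.sum_comm]
      refine Finset.sum_congr rfl fun i _ => ?_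
      rw [ht i j, map_sum, Finset.mul_sum, Finset.sum_div]
      refine Finset.sum_congr rfl fun a _ => ?_
      rw [map_mul, hφC]
      simp only [v]
      ring
    rw [h2, h1, zero_div])
  refine hlow.trans (height_le_of_fiber P φ hφ (l i0) hi0 (fun i => l (i0.succAbove i)) _ ?_)
  congr 1
  apply MvPolynomial.ringHom_ext
  · intro p
    simp only [RingHom.comp_apply, ψ, coe_eval₂Hom, eval₂_C]
    rw [eval_map]
    have : ∀ q, eval₂ (algebraMap k K) (fun a => φ (X a)) q = φ q := by
      intro q
      have h : eval₂Hom (algebraMap k K) (fun a => φ (X a)) = φ := by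
        apply MvPolynomial.ringHom_ext
        · intro c; simp [hφC]
        · intro a; simp
      exact DFunLike.congr_fun h q
    exact this p
  · intro i
    simp [ψ, v]

/-- Lower bound: a prime at which a `1`-generic matrix degenerates has large height. -/
theorem le_height_of_degen {k : Type*} [Field k] [IsAlgClosed k] {m n r : ℕ}
    (M : Matrix (Fin (m + 1)) (Fin n) (MvPolynomial (Fin (r + 1)) k))
    (hM : ∀ i j, (M i j).IsHomogeneous 1) (hgen : IsOneGeneric M)
    (P : Ideal (MvPolynomial (Fin (r + 1)) k)) [P.IsPrime] (hd : Degen M P) :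
    (n : ℕ∞) ≤ P.height + m := by
  let K := FractionRing (MvPolynomial (Fin (r + 1)) k ⧸ P)
  let φ : MvPolynomial (Fin (r + 1)) k →+* K := algebraMap _ K
  have hφ : ∀ x, φ x = 0 ↔ x ∈ P := by
    intro x
    simp only [φ]
    rw [IsScalarTower.algebraMap_apply _ (MvPolynomial (Fin (r + 1)) k ⧸ P) K,
      FaithfulSMul.algebraMap_eq_zero_iff]
    exact Ideal.Quotient.eq_zero_iff_mem
  have hφC : ∀ c : k, φ (C c) = algebraMap k K c := by
    intro c
    exact (IsScalarTower.algebraMap_apply k (MvPolynomial (Fin (r + 1)) k) K c).symm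
  exact le_height_of_degen_aux M hM hgen P hd φ hφ hφC

lemma idealHeight_eq {R : Type*} [CommRing R] (I : Ideal R) (d : ℕ∞) :
    d ≤ idealHeight I ↔ ∀ P : Ideal R, P.IsPrime → I ≤ P → d ≤ P.height := by
  unfold idealHeight
  simp only [le_iInf_iff, Set.mem_ofPred_eq]
  constructor
  · intro h P hP hIP
    have := h ⟨P, hP⟩ hIP
    rwa [← PrimeSpectrum.height_eq_orderHeight] at this
  · intro h p hp
    rw [← PrimeSpectrum.height_eq_orderHeight]
    exact h _ p.2 hp

lemma le_idealHeight_minors {k : Type*} [Field k] [IsAlgClosed k] {m n r : ℕ}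
    (M : Matrix (Fin (m + 1)) (Fin n) (MvPolynomial (Fin (r + 1)) k))
    (hM : ∀ i j, (M i j).IsHomogeneous 1) (hgen : IsOneGeneric M) (d : ℕ) (hdn : d + m = n) :
    (d : ℕ∞) ≤ idealHeight (minorsIdeal (m + 1) M) := by
  rw [idealHeight_eq]
  intro P hP hle
  have h := le_height_of_degen M hM hgen P (degen_of_minors_le hle)
  rw [← hdn] at h
  push_cast at h
  exact (ENat.add_le_add_iff_right (ENat.natCast_ne_top m)).1 h

lemma idealHeight_minors_le {k : Type*} [Field k] {m n r : ℕ}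
    (M : Matrix (Fin (m + 1)) (Fin n) (MvPolynomial (Fin (r + 1)) k))
    (hM : ∀ i j, (M i j).IsHomogeneous 1) (d : ℕ) (hdn : d + m = n) :
    idealHeight (minorsIdeal (m + 1) M) ≤ d := by
  subst hdn
  have h0 : minorsIdeal (m + 1) M ≤ RingHom.ker (constantCoeff : MvPolynomial (Fin (r + 1)) k →+* k) := by
    have : (RingHom.ker (constantCoeff : MvPolynomial (Fin (r + 1)) k →+* k)).IsPrime :=
      RingHom.ker_isPrime _
    refine minors_le_of_degen ⟨fun _ => 1, ⟨0, (Ideal.ne_top_iff_one _).1 this.ne_top⟩, ?_⟩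
    intro j
    refine Ideal.sum_mem _ fun i _ => Ideal.mul_mem_left _ _ ?_
    rw [RingHom.mem_ker, constantCoeff_eq]
    exact (hM i j).coeff_eq_zero (by simp)
  have : (RingHom.ker (constantCoeff : MvPolynomial (Fin (r + 1)) k →+* k)).IsPrime :=
    RingHom.ker_isPrime _
  obtain ⟨P, hP, -⟩ := Ideal.exists_minimalPrimes_le h0
  have hPp : P.IsPrime := hP.1.1
  have h1 := height_le_of_minimal_degen m M P (degen_of_minors_le hP.1.2) (by
    intro Q hQ hd hQP
    exact le_antisymm hQP (hP.2 ⟨hQ, minors_le_of_degen hd⟩ hQP))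
  exact ((idealHeight_eq _ _).1 le_rfl P hPp hP.1.2).trans h1

/-- For an `m × n` `1`-generic matrix `M` of homogeneous linear forms over an
algebraically closed field, with `2 ≤ m ≤ n`, the ideal `I_{m-1}(M)` has
height at least `n - m + 2`; in particular its height exceeds
`height I_m(M) = n - m + 1`. -/
theorem height_submaximalMinors {k : Type*} [Field k] [IsAlgClosed k]
    {m n r : ℕ} (hm : 2 ≤ m) (hmn : m ≤ n)
    (M : Matrix (Fin m) (Fin n) (MvPolynomial (Fin (r + 1)) k))
    (hM : ∀ i j, (M i j).IsHomogeneous 1)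
    (hgen : IsOneGeneric M) :
    ((n - m + 2 : ℕ) : ℕ∞) ≤ idealHeight (minorsIdeal (m - 1) M) ∧
      idealHeight (minorsIdeal m M) = ((n - m + 1 : ℕ) : ℕ∞) ∧
      idealHeight (minorsIdeal m M) < idealHeight (minorsIdeal (m - 1) M) := by

  obtain ⟨m, rfl⟩ : ∃ m', m = m' + 2 := ⟨m - 2, by omega⟩
  have h1 : ((n - (m + 2) + 2 : ℕ) : ℕ∞) ≤ idealHeight (minorsIdeal (m + 2 - 1) M) := by
    have h := le_idealHeight_minors (m := m) (M.submatrix Fin.succ id) (fun i j => hM _ _) (by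
      intro v hv w hw
      have := hgen (Fin.cons 0 v) (fun h => hv (by
        ext i
        simpa using congrFun h i.succ)) w hw
      rw [Fin.sum_univ_succ] at this
      simpa using this) (n - (m + 2) + 2) (by omega)
    refine h.trans ?_
    rw [idealHeight_eq]
    intro P hP hle
    refine (idealHeight_eq _ _).1 le_rfl P hP (le_trans ?_ hle)
    refine Ideal.span_mono ?_
    rintro d ⟨f, g, hf, hg, rfl⟩
    exact ⟨Fin.succ ∘ f, g, (Fin.succ_injective _).comp hf, hg, rfl⟩
  have h2 : idealHeight (minorsIdeal (m + 2) M) = ((n - (m + 2) + 1 : ℕ) : ℕ∞) :=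
    le_antisymm (idealHeight_minors_le (m := m + 1) M hM _ (by omega))
      (le_idealHeight_minors (m := m + 1) M hM hgen _ (by omega))
  refine ⟨h1, h2, ?_⟩
  rw [h2]
  refine lt_of_lt_of_le ?_ h1
  exact_mod_cast Nat.lt_succ_self _
end
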